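/- arXiv:2006.00941 — 2 statements merged into one kernel-verified Lean document; each statement's English description precedes it below -/
import Mathlib

section
/- For any two polynomials A, B ∈ ℤ[x], there exists a polynomial D ∈ ℤ[x] such that S(D) = S(A) ∩ S(B), i.e., a prime p divides some value D(n) if and only if p divides some value A(m) and some value B(k). -/
open Polynomial

/-- The product of the prime fields indexed by a set of numbers. -/
abbrev ProdZMod (T : Set ℕ) : Type := ∀ p : T, ZMod (p : ℕ)

/-- A characteristic zero quotient field of an infinite product of prime fields. -/
lemma exists_pseudo_finite (T : Set ℕ) (hinf : T.Infinite) (hT : ∀ p ∈ T, p.Prime) :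
    ∃ (F : Type) (_ : Field F) (_ : CharZero F) (φ : ProdZMod T →+* F), Function.Surjective φ := by
  classical
  have hfact : ∀ p : T, Fact (p : ℕ).Prime := fun p => ⟨hT p p.2⟩
  let I : Ideal (ProdZMod T) :=
    { carrier := {f | {p : T | f p ≠ 0}.Finite}
      add_mem' := by
        intro f g hf hg
        refine (Set.Finite.union hf hg).subset ?_
        intro p hp
        by_contra hc
        have hc' : ¬ (f p ≠ 0 ∨ g p ≠ 0) := hc
        push Not at hc'
        apply hp
        rw [Pi.add_apply, hc'.1, hc'.2, add_zero]
      zero_mem' := by simp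
      smul_mem' := by
        intro c f hf
        refine Set.Finite.subset hf ?_
        intro p hp hc
        exact hp (by simp [hc]) }
  have hI : I ≠ ⊤ := by
    intro hI
    have h1 : (1 : ProdZMod T) ∈ I := by rw [hI]; trivial
    have h2 : {p : T | (1 : ProdZMod T) p ≠ 0}.Finite := h1
    have h3 : {p : T | (1 : ProdZMod T) p ≠ 0} = Set.univ := by
      ext p; simp
    rw [h3, Set.finite_univ_iff] at h2
    exact hinf (Set.toFinite T)
  obtain ⟨M, hM, hIM⟩ := Ideal.exists_le_maximal I hI
  refine ⟨ProdZMod T ⧸ M, Ideal.Quotient.field M, ?_, Ideal.Quotient.mk M,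
    Ideal.Quotient.mk_surjective⟩
  have hz : ∀ n : ℕ, (Ideal.Quotient.mk M (n : ProdZMod T)) = 0 → n = 0 := by
    intro n hn
    by_contra hn0
    have h1 : ((n : ProdZMod T)) ∈ M := Ideal.Quotient.eq_zero_iff_mem.1 hn
    let g : ProdZMod T := fun p => ((n : ZMod (p : ℕ)))⁻¹
    have h2 : (1 - (n : ProdZMod T) * g) ∈ I := by
      have hfin : {p : T | (p : ℕ) ≤ n}.Finite :=
        Set.Finite.preimage (Subtype.val_injective.injOn) (Set.finite_Iic n)
      refine hfin.subset ?_
      intro p hp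
      by_contra hc
      apply hp
      have : (n : ZMod (p : ℕ)) ≠ 0 := by
        rw [Ne, ZMod.natCast_eq_zero_iff]
        intro hd
        exact hc (Nat.le_of_dvd (Nat.pos_of_ne_zero hn0) hd)
      simp [g, mul_inv_cancel₀ this]
    apply hM.ne_top
    rw [Ideal.eq_top_iff_one]
    have := M.add_mem (hIM h2) (M.mul_mem_right g h1)
    simpa using this
  letI : Field (ProdZMod T ⧸ M) := Ideal.Quotient.field M
  refine charZero_of_inj_zero ?_
  intro n hn
  exact hz n (by rw [map_natCast]; exact hn)

/-- Transfer from characteristic zero fields to almost all primes. -/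
lemma transfer_finite (A B D : ℤ[X])
    (h : ∀ (F : Type) [Field F] [CharZero F], (∃ x : F, aeval x A = 0) → (∃ x : F, aeval x B = 0) →
      ∃ x : F, aeval x D = 0) :
    {p : ℕ | p.Prime ∧ (∃ n : ℤ, (p : ℤ) ∣ A.eval n) ∧ (∃ n : ℤ, (p : ℤ) ∣ B.eval n) ∧
      ¬ ∃ n : ℤ, (p : ℤ) ∣ D.eval n}.Finite := by
  classical
  by_contra hinf
  set T := {p : ℕ | p.Prime ∧ (∃ n : ℤ, (p : ℤ) ∣ A.eval n) ∧ (∃ n : ℤ, (p : ℤ) ∣ B.eval n) ∧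
      ¬ ∃ n : ℤ, (p : ℤ) ∣ D.eval n} with hTdef
  have hfact : ∀ p : T, Fact (p : ℕ).Prime := fun p => ⟨p.2.1⟩
  obtain ⟨F, _, _, φ, hφ⟩ := exists_pseudo_finite T hinf (fun p hp => hp.1)
  have key : ∀ P : ℤ[X], ∀ f : ProdZMod T, ∀ p : T, (aeval f P) p = aeval (f p) P := by
    intro P f p
    exact (Polynomial.aeval_algHom_apply
      ((Pi.evalRingHom (fun p : T => ZMod (p : ℕ)) p).toIntAlgHom) f P).symm
  have keyZ : ∀ P : ℤ[X], ∀ p : T, ∀ n : ℤ,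
      (aeval (n : ZMod (p : ℕ)) P = 0 ↔ ((p : ℕ) : ℤ) ∣ P.eval n) := by
    intro P p n
    rw [← ZMod.intCast_zmod_eq_zero_iff_dvd]
    have := Polynomial.aeval_algebraMap_apply (ZMod (p : ℕ)) n P
    simp only [eq_intCast, algebraMap_int_eq, coe_aeval_eq_eval] at this
    rw [this]
  have keyM : ∀ P : ℤ[X], ∀ f : ProdZMod T, aeval (φ f) P = φ (aeval f P) := by
    intro P f
    exact Polynomial.aeval_algHom_apply (φ.toIntAlgHom) f P
  have root : ∀ P : ℤ[X], (∀ p : T, ∃ n : ℤ, ((p : ℕ) : ℤ) ∣ P.eval n) →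
      ∃ x : F, aeval x P = 0 := by
    intro P hP
    choose n hn using hP
    refine ⟨φ (fun p => (n p : ZMod (p : ℕ))), ?_⟩
    have h0 : aeval (fun p => (n p : ZMod (p : ℕ)) : ProdZMod T) P = 0 := by
      funext p
      rw [key]
      exact (keyZ P p (n p)).2 (hn p)
    rw [keyM, h0, map_zero]
  obtain ⟨x, hx⟩ := h F (root A fun p => p.2.2.1) (root B fun p => p.2.2.2.1)
  obtain ⟨f, rfl⟩ := hφ x
  rw [keyM] at hx
  let g : ProdZMod T := fun p => (aeval (f p) D)⁻¹
  have h1 : (1 : ProdZMod T) = aeval f D * g := by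
    funext p
    have hne : aeval (f p) D ≠ 0 := by
      intro h0
      obtain ⟨n, hn⟩ := ZMod.intCast_surjective (f p)
      rw [← hn] at h0
      exact p.2.2.2.2 ⟨n, (keyZ D p n).1 h0⟩
    rw [Pi.mul_apply, key]
    exact (mul_inv_cancel₀ hne).symm
  have h2 := congrArg φ h1
  rw [map_mul, hx, zero_mul, map_one] at h2
  exact one_ne_zero h2

lemma qbar_alg (x : AlgebraicClosure ℚ) : IsIntegral ℚ x := by
  have h : Algebra.IsAlgebraic ℚ (AlgebraicClosure ℚ) := by
    have e : (DivisionRing.toRatAlgebra : Algebra ℚ (AlgebraicClosure ℚ)) =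
      AlgebraicClosure.instAlgebra ℚ := Subsingleton.elim _ _
    rw [e]
    exact AlgebraicClosure.isAlgebraic ℚ
  exact (h.isAlgebraic x).isIntegral

/-- A primitive element of the field generated by two algebraic elements. -/
lemma exists_prim_gen {k K : Type} [Field k] [CharZero k] [Field K] [Algebra k K] (α β : K)
    (hint : ∀ x : K, IsIntegral k x) :
    ∃ θ : K, IntermediateField.adjoin k {θ} = IntermediateField.adjoin k {α, β} := by
  have : FiniteDimensional k (IntermediateField.adjoin k ({α, β} : Set K)) :=
    IntermediateField.finiteDimensional_adjoin (fun x _ => hint x)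
  obtain ⟨t, ht⟩ := Field.exists_primitive_element k
    (IntermediateField.adjoin k ({α, β} : Set K))
  refine ⟨t, ?_⟩
  have := congrArg (IntermediateField.lift) ht
  rwa [IntermediateField.lift_adjoin_simple, IntermediateField.lift_top] at this

lemma exists_prim (α β : AlgebraicClosure ℚ) :
    ∃ θ : AlgebraicClosure ℚ,
      IntermediateField.adjoin ℚ {θ} = IntermediateField.adjoin ℚ {α, β} :=
  exists_prim_gen α β qbar_alg

lemma exists_int_poly (P : ℚ[X]) (hP : P ≠ 0) : ∃ D : ℤ[X], D ≠ 0 ∧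
    ∀ (F : Type) [Field F] [CharZero F] (x : F), aeval x D = 0 ↔ aeval x P = 0 := by
  obtain ⟨b, hb, hm⟩ := IsLocalization.integerNormalization_spec (nonZeroDivisors ℤ) P
  have hb0 : (b : ℤ) ≠ 0 := nonZeroDivisors.ne_zero hb
  refine ⟨IsLocalization.integerNormalization (nonZeroDivisors ℤ) P, ?_, ?_⟩
  · intro h0
    rw [h0, Polynomial.map_zero] at hm
    have := hm.symm
    simp [hb0, hP] at this
  · intro F _ _ x
    rw [← Polynomial.aeval_map_algebraMap ℚ, hm]
    simp [hb0]

lemma char_zero_inter (A B : ℤ[X]) (hA : A ≠ 0) (hB : B ≠ 0) : ∃ D : ℤ[X], D ≠ 0 ∧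
    ∀ (F : Type) [Field F] [CharZero F], (∃ x : F, aeval x D = 0) ↔
      ((∃ x : F, aeval x A = 0) ∧ (∃ x : F, aeval x B = 0)) := by
  classical
  choose θ hθ using exists_prim
  let Q := AlgebraicClosure ℚ
  let S : Finset (Q × Q) := (A.aroots Q).toFinset ×ˢ (B.aroots Q).toFinset
  have hint : ∀ x : Q, IsIntegral ℚ x := qbar_alg
  obtain ⟨D, hD, hDr⟩ := exists_int_poly (∏ s ∈ S, minpoly ℚ (θ s.1 s.2))
    (Finset.prod_ne_zero_iff.2 fun s _ => minpoly.ne_zero (hint _))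
  refine ⟨D, hD, ?_⟩
  intro F _ _
  have hom_root : ∀ (P : ℤ[X]) (K L : Type) [Field K] [Field L] [Algebra ℚ K] [Algebra ℚ L]
      (φ : K →ₐ[ℚ] L) (x : K), aeval (φ x) P = 0 ↔ aeval x P = 0 := by
    intro P K L _ _ _ _ φ x
    have := Polynomial.aeval_algHom_apply (φ.toRingHom.toIntAlgHom) x P
    have h2 : aeval (φ x) P = φ (aeval x P) := this
    rw [h2, map_eq_zero]
  simp_rw [hDr]
  constructor
  · rintro ⟨x, hx⟩
    rw [map_prod, Finset.prod_eq_zero_iff] at hx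
    obtain ⟨⟨α, β⟩, hs, hx⟩ := hx
    simp only [S, Finset.mem_product, Multiset.mem_toFinset, mem_aroots] at hs hx
    let φ : IntermediateField.adjoin ℚ {θ α β} →ₐ[ℚ] F :=
      (IntermediateField.adjoin.powerBasis (hint (θ α β))).lift x (by
        rw [IntermediateField.adjoin.powerBasis_gen, IntermediateField.minpoly_gen]
        exact hx)
    have hα : α ∈ IntermediateField.adjoin ℚ {θ α β} := by
      rw [hθ]; exact IntermediateField.subset_adjoin _ _ (by simp)
    have hβ : β ∈ IntermediateField.adjoin ℚ {θ α β} := by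
      rw [hθ]; exact IntermediateField.subset_adjoin _ _ (by simp)
    refine ⟨⟨φ ⟨α, hα⟩, ?_⟩, ⟨φ ⟨β, hβ⟩, ?_⟩⟩
    · rw [hom_root, ← hom_root A _ _ (IntermediateField.val _)]
      exact hs.1.2
    · rw [hom_root, ← hom_root B _ _ (IntermediateField.val _)]
      exact hs.2.2
  · rintro ⟨⟨a, ha⟩, ⟨b, hb⟩⟩
    have alg : ∀ (P : ℤ[X]) (x : F), P ≠ 0 → aeval x P = 0 → IsIntegral ℚ x := by
      intro P x hP hx
      refine IsAlgebraic.isIntegral ⟨P.map (algebraMap ℤ ℚ), ?_, ?_⟩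
      · rwa [Ne, Polynomial.map_eq_zero_iff (RingHom.injective_int _)]
      · rwa [Polynomial.aeval_map_algebraMap]
    let E := IntermediateField.adjoin ℚ ({a, b} : Set F)
    have hfd : FiniteDimensional ℚ E := IntermediateField.finiteDimensional_adjoin (by
      rintro x (rfl | rfl)
      · exact alg A _ hA ha
      · exact alg B _ hB hb)
    let ψ : E →ₐ[ℚ] Q := IsAlgClosed.lift
    let a' : E := ⟨a, IntermediateField.subset_adjoin _ _ (by simp)⟩
    let b' : E := ⟨b, IntermediateField.subset_adjoin _ _ (by simp)⟩
    have ha' : aeval a' A = 0 := by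
      rw [← hom_root A _ _ (IntermediateField.val _)]; exact ha
    have hb' : aeval b' B = 0 := by
      rw [← hom_root B _ _ (IntermediateField.val _)]; exact hb
    have hmem : θ (ψ a') (ψ b') ∈ ψ.fieldRange := by
      have h1 : θ (ψ a') (ψ b') ∈ IntermediateField.adjoin ℚ {ψ a', ψ b'} := by
        rw [← hθ]; exact IntermediateField.subset_adjoin _ _ (by simp)
      refine (IntermediateField.adjoin_le_iff.2 ?_) h1
      rintro x (rfl | rfl)
      · exact ⟨a', rfl⟩
      · exact ⟨b', rfl⟩
    obtain ⟨t, ht⟩ := hmem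
    refine ⟨(t : F), ?_⟩
    rw [map_prod, Finset.prod_eq_zero_iff]
    refine ⟨(ψ a', ψ b'), ?_, ?_⟩
    · simp only [S, Finset.mem_product, Multiset.mem_toFinset, mem_aroots]
      exact ⟨⟨hA, (hom_root A _ _ ψ a').2 ha'⟩, ⟨hB, (hom_root B _ _ ψ b').2 hb'⟩⟩
    · have h1 : minpoly ℚ (ψ t) = minpoly ℚ t := minpoly.algHom_eq ψ ψ.injective t
      have h2 : minpoly ℚ (t : F) = minpoly ℚ t :=
        minpoly.algHom_eq (IntermediateField.val E) (IntermediateField.val E).injective t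
      have ht' : ψ t = θ (ψ a') (ψ b') := ht
      simp only
      rw [← ht', h1, ← h2]
      exact minpoly.aeval _ _

/-- Removing the prime divisors of a suitable integer. -/
lemma remove_primes (D : ℤ[X]) (hD : D ≠ 0) (e : ℤ) (he : e ≠ 0) : ∃ (D₁ : ℤ[X]) (c : ℤ), c ≠ 0 ∧
    e ∣ c ∧ ∀ p : ℕ, p.Prime → ((∃ n : ℤ, (p : ℤ) ∣ D₁.eval n) ↔
      (¬ (p : ℤ) ∣ c ∧ ∃ n : ℤ, (p : ℤ) ∣ D.eval n)) := by
  obtain ⟨a, ha⟩ : ∃ a : ℤ, D.eval a ≠ 0 := by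
    by_contra! hc
    exact hD (Polynomial.funext (by simpa using hc))
  set d := D.eval a with hd
  have hdiv := Polynomial.divX_mul_X_add (D.comp (X + C a))
  set G := (D.comp (X + C a)).divX
  have hG : ∀ x : ℤ, D.eval (x + a) = G.eval x * x + d := by
    intro x
    have := congrArg (eval x) hdiv
    simp [coeff_zero_eq_eval_zero] at this
    rw [← this]
  let c := e * d
  have hev : ∀ n : ℤ, d * (1 + C c * X * G.comp (C (d * c) * X) : ℤ[X]).eval n
      = D.eval (d * c * n + a) := by
    intro n
    rw [hG]
    simp
    ring
  refine ⟨1 + C c * X * G.comp (C (d * c) * X), c, mul_ne_zero he ha, ⟨d, rfl⟩, ?_⟩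
  intro p hp
  have hp' : Prime (p : ℤ) := Nat.prime_iff_prime_int.1 hp
  constructor
  · rintro ⟨n, hn⟩
    refine ⟨?_, d * c * n + a, ?_⟩
    · intro hc
      apply hp'.not_dvd_one
      have h2 : (p : ℤ) ∣ c * (n * G.eval (d * c * n)) := hc.mul_right _
      have h3 := dvd_sub hn h2
      simp at h3
      ring_nf at h3
      exact h3
    · rw [← hev]; exact hn.mul_left _
  · rintro ⟨hc, m, hm⟩
    have hpd : ¬ (p : ℤ) ∣ d := fun h => hc (h.mul_left _)
    have hcop : IsCoprime (d * c) (p : ℤ) :=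
      (((Prime.coprime_iff_not_dvd hp').2 (fun h => (hp'.dvd_or_dvd h).elim hpd hc))).symm
    obtain ⟨u, v, huv⟩ := hcop
    refine ⟨u * (m - a), ?_⟩
    have h1 : (p : ℤ) ∣ d * (1 + C c * X * G.comp (C (d * c) * X) : ℤ[X]).eval (u * (m - a)) := by
      rw [hev]
      have h2 : (p : ℤ) ∣ (d * c * (u * (m - a)) + a) - m :=
        ⟨-(v * (m - a)), by linear_combination (m - a) * huv⟩
      have h3 := h2.trans (Polynomial.sub_dvd_eval_sub _ _ D)
      exact (dvd_iff_dvd_of_dvd_sub h3).2 hm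
    exact (hp'.dvd_or_dvd h1).resolve_left hpd

theorem primeDivisors_inter_two (A B : Polynomial ℤ) :
    ∃ D : Polynomial ℤ,
      {p : ℕ | p.Prime ∧ ∃ n : ℤ, (p : ℤ) ∣ D.eval n} =
        {p : ℕ | p.Prime ∧ ∃ m : ℤ, (p : ℤ) ∣ A.eval m} ∩
          {p : ℕ | p.Prime ∧ ∃ k : ℤ, (p : ℤ) ∣ B.eval k} := by
  classical
  by_cases hA : A = 0
  · refine ⟨B, ?_⟩
    ext p
    simp [hA]
    try tauto
  by_cases hB : B = 0
  · refine ⟨A, ?_⟩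
    ext p
    simp [hB]
    try tauto
  obtain ⟨D, hD, hF⟩ := char_zero_inter A B hA hB
  have f1 := transfer_finite D D A (fun F _ _ h _ => ((hF F).1 h).1)
  have f2 := transfer_finite D D B (fun F _ _ h _ => ((hF F).1 h).2)
  have f3 := transfer_finite A B D (fun F _ _ h h' => (hF F).2 ⟨h, h'⟩)
  have fU := (f1.union f2).union f3
  set U := fU.toFinset with hU
  have hUp : ∀ p ∈ U, p.Prime := by
    intro p hp
    rw [hU, Set.Finite.mem_toFinset] at hp
    rcases hp with (hp | hp) | hp <;> exact hp.1
  obtain ⟨D₁, c, hc, hec, hD₁⟩ := remove_primes D hD ((∏ p ∈ U, p : ℕ) : ℤ) (by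
    exact_mod_cast Finset.prod_ne_zero_iff.2 fun p hp => (hUp p hp).ne_zero)
  have hUc : ∀ p ∈ U, (p : ℤ) ∣ c := fun p hp =>
    (Int.natCast_dvd_natCast.2 (Finset.dvd_prod_of_mem _ hp)).trans hec
  let V : Finset ℕ := c.natAbs.primeFactors.filter
    (fun p : ℕ => (∃ n : ℤ, (p : ℤ) ∣ A.eval n) ∧ (∃ n : ℤ, (p : ℤ) ∣ B.eval n))
  have hV : ∀ p : ℕ, p.Prime → ((p : ℤ) ∣ ((∏ q ∈ V, q : ℕ) : ℤ) ↔ p ∈ V) := by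
    intro p hp
    rw [Int.natCast_dvd_natCast, hp.prime.dvd_finsetProd_iff]
    constructor
    · rintro ⟨q, hq, hpq⟩
      have hqp : q.Prime := Nat.prime_of_mem_primeFactors (Finset.mem_filter.1 hq).1
      rwa [(Nat.prime_dvd_prime_iff_eq hp hqp).1 hpq]
    · intro h
      exact ⟨p, h, dvd_rfl⟩
  refine ⟨C ((∏ q ∈ V, q : ℕ) : ℤ) * D₁, ?_⟩
  ext p
  simp only [Set.mem_inter_iff, Set.mem_ofPred_eq]
  by_cases hp : p.Prime
  swap
  · simp [hp]
  have hp' : Prime (p : ℤ) := Nat.prime_iff_prime_int.1 hp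
  have h1 : (∃ n : ℤ, (p : ℤ) ∣ (C ((∏ q ∈ V, q : ℕ) : ℤ) * D₁).eval n) ↔
      (p ∈ V ∨ ∃ n : ℤ, (p : ℤ) ∣ D₁.eval n) := by
    simp only [eval_mul, eval_C, hp'.dvd_mul, hV p hp]
    constructor
    · rintro ⟨n, h | h⟩
      · exact Or.inl h
      · exact Or.inr ⟨n, h⟩
    · rintro (h | ⟨n, h⟩)
      · exact ⟨0, Or.inl h⟩
      · exact ⟨n, Or.inr h⟩
  have h2 : p ∈ V ↔ ((p : ℤ) ∣ c ∧ (∃ n : ℤ, (p : ℤ) ∣ A.eval n) ∧ (∃ n : ℤ, (p : ℤ) ∣ B.eval n)) := by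
    have h4 : p ∈ c.natAbs.primeFactors ↔ (p : ℤ) ∣ c := by
      rw [Nat.mem_primeFactors, Int.natCast_dvd]
      simp [hp, hc]
    rw [← h4]
    exact Finset.mem_filter
  rw [and_iff_right hp, h1, h2, hD₁ p hp]
  have h3 : ¬ (p : ℤ) ∣ c → ((∃ n : ℤ, (p : ℤ) ∣ D.eval n) ↔
      (∃ n : ℤ, (p : ℤ) ∣ A.eval n) ∧ (∃ n : ℤ, (p : ℤ) ∣ B.eval n)) := by
    intro hpc
    have hpU : p ∉ U := fun h => hpc (hUc p h)
    rw [hU, Set.Finite.mem_toFinset] at hpU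
    constructor
    · intro hd
      constructor
      · by_contra hn
        exact hpU (Or.inl (Or.inl ⟨hp, hd, hd, hn⟩))
      · by_contra hn
        exact hpU (Or.inl (Or.inr ⟨hp, hd, hd, hn⟩))
    · rintro ⟨ha, hb⟩
      by_contra hn
      exact hpU (Or.inr ⟨hp, ha, hb, hn⟩)
  constructor
  · rintro (⟨_, ha, hb⟩ | ⟨h, hd⟩)
    · exact ⟨⟨hp, ha⟩, ⟨hp, hb⟩⟩
    · exact ⟨⟨hp, ((h3 h).1 hd).1⟩, ⟨hp, ((h3 h).1 hd).2⟩⟩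
  · rintro ⟨⟨_, ha⟩, ⟨_, hb⟩⟩
    by_cases h : (p : ℤ) ∣ c
    · exact Or.inl ⟨h, ha, hb⟩
    · exact Or.inr ⟨h, (h3 h).2 ⟨ha, hb⟩⟩
end

section
/- For any finite family P₁, …, Pₙ ∈ ℤ[x], there exists D ∈ ℤ[x] with S(D) = S(P₁) ∩ S(P₂) ∩ … ∩ S(Pₙ). -/
open Polynomial

/-- Evaluation of an integer polynomial in a ring. -/
noncomputable def ev {F : Type} [CommRing F] (x : F) (P : ℤ[X]) : F :=
  eval₂ (Int.castRingHom F) x P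

lemma ev_hom {A B : Type} [CommRing A] [CommRing B] (f : A →+* B) (P : ℤ[X]) (x : A) :
    ev (f x) P = f (ev x P) := by
  unfold ev
  rw [hom_eval₂]
  congr 1
  exact RingHom.ext_int _ _

lemma ev_eq_aeval {F : Type} [CommRing F] (x : F) (P : ℤ[X]) : ev x P = aeval x P := by
  unfold ev
  rw [aeval_def]
  congr 1

/-- `P` has a root in the ring `F`. -/
def HasRt (F : Type) [CommRing F] (P : ℤ[X]) : Prop := ∃ x : F, ev x P = 0

lemma hasRt_zmod (p : ℕ) (P : ℤ[X]) :
    HasRt (ZMod p) P ↔ ∃ m : ℤ, (p : ℤ) ∣ P.eval m := by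
  have key : ∀ m : ℤ, ev (m : ZMod p) P = ((P.eval m : ℤ) : ZMod p) := by
    intro m
    have := ev_hom (Int.castRingHom (ZMod p)) P m
    simpa [ev, eval₂_eq_eval_map] using this
  constructor
  · rintro ⟨x, hx⟩
    obtain ⟨m, rfl⟩ := ZMod.intCast_surjective x
    exact ⟨m, (ZMod.intCast_zmod_eq_zero_iff_dvd _ _).1 (by rw [← key, hx])⟩
  · rintro ⟨m, hm⟩
    exact ⟨m, by rw [key]; exact (ZMod.intCast_zmod_eq_zero_iff_dvd _ _).2 hm⟩

/-- The product of the residue fields. -/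
abbrev ProdRing (s : Set ℕ) : Type := ∀ p : s, ZMod (p : ℕ)

/-- Finitely supported elements. -/
def finSuppIdeal (s : Set ℕ) : Ideal (ProdRing s) where
  carrier := {f | {p : s | f p ≠ 0}.Finite}
  add_mem' := by
    intro a b ha hb
    refine (Set.Finite.union ha hb).subset ?_
    intro p hpp
    by_contra h
    rw [Set.mem_union, not_or] at h
    have h1 : a p = 0 := not_not.1 h.1
    have h2 : b p = 0 := not_not.1 h.2
    exact hpp (by rw [Pi.add_apply, h1, h2, add_zero])
  zero_mem' := by
    change {p : s | (0 : ProdRing s) p ≠ 0}.Finite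
    simp
  smul_mem' := by
    intro c a ha
    refine Set.Finite.subset ha ?_
    intro p hpp h
    exact hpp (by rw [smul_eq_mul, Pi.mul_apply, h, mul_zero])

lemma mem_finSuppIdeal (s : Set ℕ) (f : ProdRing s) :
    f ∈ finSuppIdeal s ↔ {p : s | f p ≠ 0}.Finite := Iff.rfl

lemma exists_field_quot {R : Type} [CommRing R] (I : Ideal R) (hI : I ≠ ⊤) :
    ∃ (F : Type) (_ : Field F) (φ : R →+* F), Function.Surjective φ ∧ ∀ x ∈ I, φ x = 0 := by
  obtain ⟨m, hm, hIm⟩ := Ideal.exists_le_maximal I hI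
  exact ⟨R ⧸ m, Ideal.Quotient.field m, Ideal.Quotient.mk m, Ideal.Quotient.mk_surjective,
    fun x hx => Ideal.Quotient.eq_zero_iff_mem.2 (hIm hx)⟩

/-- Transfer to a field of characteristic zero (an ultraproduct). -/
lemma transfer (s : Set ℕ) (hs : s.Infinite) (hp : ∀ p ∈ s, p.Prime) :
    ∃ (F : Type) (_ : Field F), CharZero F ∧
      (∀ P : ℤ[X], (∀ p ∈ s, HasRt (ZMod p) P) → HasRt F P) ∧
      (∀ P : ℤ[X], (∀ p ∈ s, ¬ HasRt (ZMod p) P) → ¬ HasRt F P) := by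
  classical
  have : ∀ p : s, Fact (p : ℕ).Prime := fun p => ⟨hp p p.2⟩
  have hI : finSuppIdeal s ≠ ⊤ := by
    intro h
    have h1 : (1 : ProdRing s) ∈ finSuppIdeal s := by rw [h]; trivial
    rw [mem_finSuppIdeal] at h1
    have h3 : {p : s | (1 : ProdRing s) p ≠ 0} = Set.univ := by
      ext p; simp
    rw [h3] at h1
    have := hs.to_subtype
    exact Set.infinite_univ h1
  obtain ⟨F, instF, φ, hsurj, hφ⟩ := exists_field_quot _ hI
  have hae : ∀ (P : ℤ[X]) (f : ProdRing s) (p : s), (ev f P) p = ev (f p) P := by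
    intro P f p
    exact (ev_hom (Pi.evalRingHom (fun p : s => ZMod (p : ℕ)) p) P f).symm
  refine ⟨F, instF, ?_, ?_, ?_⟩
  · refine charZero_of_inj_zero ?_
    intro n hn
    by_contra hn0
    let u : ProdRing s := fun p => ((n : ZMod (p : ℕ)))⁻¹
    have h1 : 1 - u * (n : ProdRing s) ∈ finSuppIdeal s := by
      rw [mem_finSuppIdeal]
      have hfin : {p : s | (p : ℕ) ∣ n}.Finite := by
        have : ((fun p : s => (p : ℕ)) ⁻¹' (n.divisors : Set ℕ)).Finite :=
          (n.divisors.finite_toSet).preimage Subtype.val_injective.injOn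
        refine this.subset ?_
        intro p hpn
        have h' : (p : ℕ) ∣ n := hpn
        simpa using ⟨h', hn0⟩
      refine hfin.subset ?_
      intro p hpp
      by_contra h
      apply hpp
      have : (n : ZMod (p : ℕ)) ≠ 0 := by
        rw [Ne, ZMod.natCast_eq_zero_iff]; exact h
      simp [u, this]
    have h2 := hφ _ h1
    simp [hn] at h2
  · intro P h
    have h' : ∀ p : s, ∃ x : ZMod (p : ℕ), ev x P = 0 := fun p => h p p.2
    choose g hg using h'
    refine ⟨φ g, ?_⟩
    rw [ev_hom]
    have : ev (F := ProdRing s) g P = 0 := by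
      funext p; rw [hae]; exact hg p
    rw [this, map_zero]
  · rintro P h ⟨x, hx⟩
    obtain ⟨f, rfl⟩ := hsurj x
    rw [ev_hom] at hx
    have hu : IsUnit (ev f P) := by
      rw [Pi.isUnit_iff]
      intro p
      rw [isUnit_iff_ne_zero, hae]
      intro h0
      exact h p p.2 ⟨_, h0⟩
    exact (hu.map φ).ne_zero hx

lemma exists_prim_s9 {k L : Type} [Field k] [CharZero k] [Field L] [Algebra k L] [Algebra.IsAlgebraic k L] (a b : L) :
    ∃ t : L, IntermediateField.adjoin k {t} = IntermediateField.adjoin k {a, b} := by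
  have : FiniteDimensional k (IntermediateField.adjoin k {a, b}) :=
    IntermediateField.finiteDimensional_adjoin
      (fun x _ => (Algebra.IsAlgebraic.isAlgebraic (R := k) x).isIntegral)
  obtain ⟨t, ht⟩ := Field.exists_primitive_element k (IntermediateField.adjoin k {a, b})
  refine ⟨t, ?_⟩
  have := congrArg (IntermediateField.map (IntermediateField.val _)) ht
  rw [IntermediateField.adjoin_map] at this
  simpa [← AlgHom.fieldRange_eq_map] using this

lemma compos_forward {k L F : Type} [Field k] [Field L] [Field F] [Algebra k L] [Algebra k F]
    [Algebra.IsAlgebraic k L] (t a : L) (haK : a ∈ IntermediateField.adjoin k {t}) (x : F)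
    (hx : aeval x (minpoly k t) = 0) (P : ℤ[X]) (h : ev a P = 0) : HasRt F P := by
  have hint : IsIntegral k t := (Algebra.IsAlgebraic.isAlgebraic (R := k) _).isIntegral
  let f : IntermediateField.adjoin k {t} →ₐ[k] F :=
    (IntermediateField.adjoin.powerBasis hint).lift x (by
      rw [IntermediateField.adjoin.powerBasis_gen, IntermediateField.minpoly_gen]; exact hx)
  refine ⟨f ⟨a, haK⟩, ?_⟩
  have h1 : ev (⟨a, haK⟩ : IntermediateField.adjoin k {t}) P = 0 := by
    apply (algebraMap (IntermediateField.adjoin k {t}) L).injective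
    rw [← ev_hom, map_zero]; exact h
  have := ev_hom (f : IntermediateField.adjoin k {t} →+* F) P ⟨a, haK⟩
  rw [h1, map_zero] at this
  exact this

lemma compos_backward {k L F : Type} [Field k] [Field L] [Field F] [Algebra k L] [Algebra k F]
    [IsAlgClosed L] (x y : F) (hx : IsIntegral k x) (hy : IsIntegral k y) :
    ∃ a b : L, (∀ P : ℤ[X], ev x P = 0 → ev a P = 0) ∧ (∀ P : ℤ[X], ev y P = 0 → ev b P = 0) ∧
      ∀ z ∈ IntermediateField.adjoin k {a, b}, ∃ t : F, aeval t (minpoly k z) = 0 := by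
  let K := IntermediateField.adjoin k ({x, y} : Set F)
  have hKalg : Algebra.IsAlgebraic k K := by
    apply IntermediateField.isAlgebraic_adjoin
    intro z hz
    rcases hz with rfl | rfl
    · exact hx
    · exact hy
  let σ : K →ₐ[k] L := IsAlgClosed.lift
  have hxK : x ∈ K := IntermediateField.subset_adjoin _ _ (by simp)
  have hyK : y ∈ K := IntermediateField.subset_adjoin _ _ (by simp)
  have go : ∀ (c : F) (hc : c ∈ K) (P : ℤ[X]), ev c P = 0 → ev (σ ⟨c, hc⟩) P = 0 := by
    intro c hc P h
    have h1 : ev (⟨c, hc⟩ : K) P = 0 := by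
      apply (algebraMap K F).injective
      rw [← ev_hom, map_zero]; exact h
    have := ev_hom (σ : K →+* L) P ⟨c, hc⟩
    rw [h1, map_zero] at this
    exact this
  refine ⟨σ ⟨x, hxK⟩, σ ⟨y, hyK⟩, go x hxK, go y hyK, ?_⟩
  intro w hw
  have hmem : w ∈ σ.fieldRange := by
    refine (IntermediateField.adjoin_le_iff.2 ?_) hw
    rintro z (rfl | rfl)
    · exact ⟨_, rfl⟩
    · exact ⟨_, rfl⟩
  obtain ⟨t, ht⟩ := hmem
  refine ⟨(t : F), ?_⟩
  have ht' : σ t = w := ht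
  rw [← ht', minpoly.algHom_eq σ σ.injective]
  have := Polynomial.aeval_algHom_apply K.val t (minpoly k t)
  rw [minpoly.aeval, map_zero] at this
  exact this

lemma exists_alg_closed (k : Type) [Field k] : ∃ (L : Type) (_ : Field L) (_ : Algebra k L),
    Algebra.IsAlgebraic k L ∧ IsAlgClosed L :=
  ⟨AlgebraicClosure k, inferInstance, inferInstance, inferInstance, inferInstance⟩

lemma exists_clear (f : ℚ[X]) : ∃ g : ℤ[X], ∀ (F : Type) [Field F] [CharZero F] (x : F),
    ev x g = 0 ↔ aeval x f = 0 := by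
  obtain ⟨c, hc, hmap⟩ := IsLocalization.integerNormalization_spec (nonZeroDivisors ℤ) f
  refine ⟨IsLocalization.integerNormalization (nonZeroDivisors ℤ) f, fun F _ _ x => ?_⟩
  · rw [ev_eq_aeval, ← Polynomial.aeval_map_algebraMap ℚ x, hmap]
    have hc0 : (c : F) ≠ 0 := by
      exact_mod_cast nonZeroDivisors.ne_zero hc
    rw [map_zsmul, zsmul_eq_mul, mul_eq_zero]
    simp [hc0]

lemma exists_comp_aux (L : Type) [Field L] [Algebra ℚ L] [Algebra.IsAlgebraic ℚ L]
    [IsAlgClosed L] (P Q : ℤ[X]) (hP : P ≠ 0) (hQ : Q ≠ 0) :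
    ∃ D : ℤ[X], ∀ (F : Type) [Field F] [CharZero F],
      HasRt F D ↔ HasRt F P ∧ HasRt F Q := by
  classical
  have : CharZero L := algebraRat.charZero L
  choose θ hθ using exists_prim_s9 (k := ℚ) (L := L)
  choose d hd using fun a b => exists_clear (minpoly ℚ (θ a b))
  refine ⟨∏ a ∈ (P.aroots L).toFinset, ∏ b ∈ (Q.aroots L).toFinset, d a b, ?_⟩
  intro F _ _
  have hfact : HasRt F (∏ a ∈ (P.aroots L).toFinset, ∏ b ∈ (Q.aroots L).toFinset, d a b) ↔
      ∃ a b : L, ev a P = 0 ∧ ev b Q = 0 ∧ ∃ x : F, aeval x (minpoly ℚ (θ a b)) = 0 := by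
    unfold HasRt
    simp only [← hd]
    simp only [ev_eq_aeval, map_prod, Finset.prod_eq_zero_iff, Multiset.mem_toFinset,
      Polynomial.mem_aroots]
    constructor
    · rintro ⟨x, a, ha, b, hb, h⟩
      exact ⟨a, b, ha.2, hb.2, x, h⟩
    · rintro ⟨a, b, ha, hb, x, h⟩
      exact ⟨x, a, ⟨hP, ha⟩, b, ⟨hQ, hb⟩, h⟩
  rw [hfact]
  have halg : ∀ (P : ℤ[X]) (_ : P ≠ 0) (x : F), ev x P = 0 → IsIntegral ℚ x := by
    intro P hP x hx
    rw [ev_eq_aeval] at hx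
    apply IsAlgebraic.isIntegral
    refine ⟨P.map (algebraMap ℤ ℚ), ?_, ?_⟩
    · exact (Polynomial.map_ne_zero_iff (algebraMap ℤ ℚ).injective_int).2 hP
    · rw [Polynomial.aeval_map_algebraMap]; exact hx
  constructor
  · rintro ⟨a, b, ha, hb, x, hx⟩
    exact ⟨compos_forward (θ a b) a
        (by rw [hθ]; exact IntermediateField.subset_adjoin _ _ (by simp)) x hx P ha,
      compos_forward (θ a b) b
        (by rw [hθ]; exact IntermediateField.subset_adjoin _ _ (by simp)) x hx Q hb⟩
  · rintro ⟨⟨x, hx⟩, ⟨y, hy⟩⟩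
    obtain ⟨a, b, ha, hb, h⟩ := compos_backward (k := ℚ) (L := L) x y (halg P hP x hx)
      (halg Q hQ y hy)
    refine ⟨a, b, ha P hx, hb Q hy, h _ ?_⟩
    rw [← hθ]; exact IntermediateField.subset_adjoin _ _ (by simp)

/-- Key algebraic fact: compositum polynomial. -/
lemma exists_comp (P Q : ℤ[X]) (hP : P ≠ 0) (hQ : Q ≠ 0) :
    ∃ D : ℤ[X], ∀ (F : Type) [Field F] [CharZero F],
      HasRt F D ↔ HasRt F P ∧ HasRt F Q := by
  obtain ⟨L, _, _, _, _⟩ := exists_alg_closed ℚ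
  exact exists_comp_aux L P Q hP hQ

/-- Finite modifications of a set of prime divisors. -/
lemma modify_finite (D : ℤ[X]) (T : Set ℕ)
    (hfin : {p : ℕ | p.Prime ∧ ¬ (HasRt (ZMod p) D ↔ p ∈ T)}.Finite) :
    ∃ D' : ℤ[X], ∀ p : ℕ, p.Prime → (HasRt (ZMod p) D' ↔ p ∈ T) := by
  classical
  obtain ⟨E, hE0, hE⟩ : ∃ E : ℤ[X], E.eval 0 ≠ 0 ∧
      ∀ p : ℕ, HasRt (ZMod p) E ↔ HasRt (ZMod p) D := by
    by_cases hD : D = 0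
    · refine ⟨X + 1, by simp, fun p => ?_⟩
      subst hD
      refine ⟨fun _ => ⟨0, by simp [ev_eq_aeval]⟩, fun _ => ⟨-1, by simp [ev_eq_aeval]⟩⟩
    · obtain ⟨m, hm⟩ : ∃ m : ℤ, D.eval m ≠ 0 := by
        by_contra! h
        exact hD (Polynomial.funext (by simpa using h))
      refine ⟨D.comp (X + C m), by simpa using hm, fun p => ?_⟩
      constructor
      · rintro ⟨x, hx⟩
        exact ⟨x + m, by simpa [ev_eq_aeval, aeval_comp] using hx⟩
      · rintro ⟨x, hx⟩
        exact ⟨x - m, by simpa [ev_eq_aeval, aeval_comp] using hx⟩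
  set c := E.eval 0 with hc
  set N : ℤ := c * ∏ p ∈ hfin.toFinset, (p : ℤ) with hN
  have hN0 : N ≠ 0 := by
    refine mul_ne_zero hE0 (Finset.prod_ne_zero_iff.2 ?_)
    intro p hp
    simp only [Set.Finite.mem_toFinset, Set.mem_ofPred_eq] at hp
    exact_mod_cast hp.1.ne_zero
  have hEG : E = X * E.divX + C c := by
    rw [hc, ← coeff_zero_eq_eval_zero]; exact (X_mul_divX_add E).symm
  set G := E.divX
  let E1 : ℤ[X] := 1 + C N * X * G.comp (C (c * N) * X)
  have hE1 : ∀ (p : ℕ) (x : ZMod p), (c : ZMod p) * ev x E1 = ev ((c * N : ZMod p) * x) E := by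
    intro p x
    rw [hEG]
    simp [ev_eq_aeval, E1, aeval_comp]
    ring
  let M : ℤ := ∏ p ∈ N.natAbs.primeFactors.filter (· ∈ T), (p : ℤ)
  have hroot : ∀ p : ℕ, p.Prime → (HasRt (ZMod p) (C M * E1) ↔ ((M : ZMod p) = 0 ∨ HasRt (ZMod p) E1)) := by
    intro p hp
    have : Fact p.Prime := ⟨hp⟩
    unfold HasRt
    simp [ev_eq_aeval, mul_eq_zero, exists_or]
  have hM : ∀ p : ℕ, p.Prime → ((M : ZMod p) = 0 ↔ ((p : ℤ) ∣ N ∧ p ∈ T)) := by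
    intro p hp
    rw [ZMod.intCast_zmod_eq_zero_iff_dvd]
    have hpp : Prime (p : ℤ) := Nat.prime_iff_prime_int.1 hp
    constructor
    · intro h
      obtain ⟨q, hq, hpq⟩ := (hpp.dvd_finsetProd_iff _).1 h
      simp only [Finset.mem_filter, Nat.mem_primeFactors] at hq
      have : p = q := (Nat.prime_dvd_prime_iff_eq hp hq.1.1).1 (by exact_mod_cast hpq)
      subst this
      exact ⟨Int.natCast_dvd.2 hq.1.2.1, hq.2⟩
    · rintro ⟨h1, h2⟩
      refine Finset.dvd_prod_of_mem (fun q : ℕ => (q : ℤ)) ?_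
      simp only [Finset.mem_filter, Nat.mem_primeFactors]
      exact ⟨⟨hp, Int.natCast_dvd.1 h1, by simpa using hN0⟩, h2⟩
  refine ⟨C M * E1, fun p hp => ?_⟩
  have : Fact p.Prime := ⟨hp⟩
  rw [hroot p hp, hM p hp]
  by_cases hpN : (p : ℤ) ∣ N
  · have hno : ¬ HasRt (ZMod p) E1 := by
      rintro ⟨x, hx⟩
      have : (N : ZMod p) = 0 := (ZMod.intCast_zmod_eq_zero_iff_dvd _ _).2 hpN
      simp [ev_eq_aeval, E1, this] at hx
    tauto
  · have hNp : (N : ZMod p) ≠ 0 := fun h => hpN ((ZMod.intCast_zmod_eq_zero_iff_dvd _ _).1 h)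
    have hcp : (c : ZMod p) ≠ 0 := by
      intro h
      apply hNp
      rw [hN]; push_cast; rw [h, zero_mul]
    have hT : HasRt (ZMod p) D ↔ p ∈ T := by
      by_contra h
      apply hpN
      rw [hN]
      refine Dvd.dvd.mul_left (Finset.dvd_prod_of_mem (fun q : ℕ => (q : ℤ)) ?_) _
      simp only [Set.Finite.mem_toFinset, Set.mem_ofPred_eq]
      exact ⟨hp, h⟩
    have hEE : HasRt (ZMod p) E1 ↔ HasRt (ZMod p) E := by
      constructor
      · rintro ⟨x, hx⟩
        exact ⟨_, by rw [← hE1 p x, hx, mul_zero]⟩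
      · rintro ⟨y, hy⟩
        refine ⟨(c * N : ZMod p)⁻¹ * y, ?_⟩
        have := hE1 p ((c * N : ZMod p)⁻¹ * y)
        rw [mul_inv_cancel_left₀ (mul_ne_zero hcp hNp), hy] at this
        exact (mul_eq_zero.1 this).resolve_left hcp
    rw [hEE, hE, hT]
    tauto

lemma inter_two (P Q : ℤ[X]) :
    ∃ D : ℤ[X], ∀ p : ℕ, p.Prime →
      (HasRt (ZMod p) D ↔ HasRt (ZMod p) P ∧ HasRt (ZMod p) Q) := by
  have hz : ∀ p : ℕ, HasRt (ZMod p) 0 := fun p => ⟨0, by simp [ev_eq_aeval]⟩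
  by_cases hP : P = 0
  · exact ⟨Q, fun p _ => by subst hP; simp [hz p]⟩
  by_cases hQ : Q = 0
  · exact ⟨P, fun p _ => by subst hQ; simp [hz p]⟩
  obtain ⟨D, hD⟩ := exists_comp P Q hP hQ
  have h1 : {p : ℕ | p.Prime ∧ (HasRt (ZMod p) P ∧ HasRt (ZMod p) Q) ∧ ¬ HasRt (ZMod p) D}.Finite := by
    by_contra h
    obtain ⟨F, _, _, hy, hn⟩ := transfer _ h (fun p hp => hp.1)
    exact hn D (fun p hp => hp.2.2)
      ((hD F).2 ⟨hy P (fun p hp => hp.2.1.1), hy Q (fun p hp => hp.2.1.2)⟩)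
  have h2 : ∀ R : ℤ[X], (R = P ∨ R = Q) →
      {p : ℕ | p.Prime ∧ HasRt (ZMod p) D ∧ ¬ HasRt (ZMod p) R}.Finite := by
    intro R hR
    by_contra h
    obtain ⟨F, _, _, hy, hn⟩ := transfer _ h (fun p hp => hp.1)
    have := (hD F).1 (hy D (fun p hp => hp.2.1))
    refine hn R (fun p hp => hp.2.2) ?_
    rcases hR with rfl | rfl
    · exact this.1
    · exact this.2
  refine modify_finite D {p | HasRt (ZMod p) P ∧ HasRt (ZMod p) Q} ?_
  refine (h1.union ((h2 P (Or.inl rfl)).union (h2 Q (Or.inr rfl)))).subset ?_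
  rintro p ⟨hp, h⟩
  simp only [Set.mem_union, Set.mem_ofPred_eq] at h ⊢
  tauto

lemma inter_fin (n : ℕ) (P : Fin n → ℤ[X]) :
    ∃ D : ℤ[X], ∀ p : ℕ, p.Prime →
      (HasRt (ZMod p) D ↔ ∀ i, HasRt (ZMod p) (P i)) := by
  induction n with
  | zero => exact ⟨0, fun p _ => ⟨fun _ i => i.elim0, fun _ => ⟨0, by simp [ev_eq_aeval]⟩⟩⟩
  | succ k ih =>
    obtain ⟨D, hD⟩ := ih (fun i => P i.succ)
    obtain ⟨D', hD'⟩ := inter_two (P 0) D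
    refine ⟨D', fun p hp => ?_⟩
    rw [hD' p hp, hD p hp, Fin.forall_fin_succ]

theorem primeDivisors_inter (n : ℕ) (P : Fin n → Polynomial ℤ) :
    ∃ D : Polynomial ℤ,
      {p : ℕ | p.Prime ∧ ∃ m : ℤ, (p : ℤ) ∣ D.eval m} =
        {p : ℕ | p.Prime} ∩ ⋂ i : Fin n, {p : ℕ | ∃ m : ℤ, (p : ℤ) ∣ (P i).eval m} := by
  obtain ⟨D, hD⟩ := inter_fin n P
  refine ⟨D, ?_⟩
  ext p
  simp only [Set.mem_ofPred_eq, Set.mem_inter_iff, Set.mem_iInter, ← hasRt_zmod]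
  exact ⟨fun h => ⟨h.1, (hD p h.1).1 h.2⟩, fun h => ⟨h.1, (hD p h.1).2 h.2⟩⟩
end
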